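/- arXiv:2110.10678 — 4 statements merged into one kernel-verified Lean document; each statement's English description precedes it below -/
import Mathlib

section
/- Let N ≥ 2, let w : Fin N → Fin N → ℝ be symmetric with w i j ≥ 0 and w i i = 0, let L be the associated weighted Laplacian, and assume the graph with an edge between distinct i, j whenever w i j > 0 is connected. Let D ∈ ℝ^{N×N} be a diagonal matrix with nonnegative diagonal entries κ_{g,1}, …, κ_{g,N}, at least one of which is strictly positive, and let κ_f > 0. Then the symmetric matrix D + κ_f L is positive definite (equivalently, −(D + κ_f L) is Hurwitz). -/
open Matrix BigOperators

/-- The Laplacian quadratic form of a symmetric weight is a weighted sum of squared differences. -/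
theorem dotProduct_laplacian_mulVec {n : Type*} [Fintype n] [DecidableEq n] (w : n → n → ℝ)
    (hw : ∀ i j, w i j = w j i) (x : n → ℝ) :
    x ⬝ᵥ ((Matrix.diagonal (fun i => ∑ j, w i j) - Matrix.of w) *ᵥ x) =
      (∑ i, ∑ j, w i j * (x i - x j) ^ 2) / 2 := by
  have hleft : x ⬝ᵥ ((Matrix.diagonal (fun i => ∑ j, w i j) - Matrix.of w) *ᵥ x) =
      ∑ i, ∑ j, w i j * (x i ^ 2 - x i * x j) := by
    simp only [Matrix.sub_mulVec, dotProduct, Pi.sub_apply, Matrix.mulVec_diagonal]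
    refine Finset.sum_congr rfl fun i _ => ?_
    simp only [Matrix.mulVec, dotProduct, Matrix.of_apply]
    rw [Finset.sum_mul, ← Finset.sum_sub_distrib, Finset.mul_sum]
    exact Finset.sum_congr rfl fun j _ => by ring
  have hswap : ∑ i, ∑ j, w i j * (x i ^ 2 - x i * x j) =
      ∑ i, ∑ j, w i j * (x j ^ 2 - x i * x j) := by
    rw [Finset.sum_comm]
    refine Finset.sum_congr rfl fun i _ => Finset.sum_congr rfl fun j _ => ?_
    rw [hw j i]
    ring
  have hsum : ∑ i, ∑ j, w i j * (x i - x j) ^ 2 =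
      ∑ i, ∑ j, w i j * (x i ^ 2 - x i * x j) + ∑ i, ∑ j, w i j * (x j ^ 2 - x i * x j) := by
    simp only [← Finset.sum_add_distrib]
    exact Finset.sum_congr rfl fun i _ => Finset.sum_congr rfl fun j _ => by ring
  rw [hleft, hsum, ← hswap]
  ring

/-- A function that agrees on adjacent vertices of a connected graph is constant. -/
theorem SimpleGraph.Connected.apply_eq_of_adj {V α : Type*} {G : SimpleGraph V}
    (hG : G.Connected) {x : V → α} (h : ∀ i j, G.Adj i j → x i = x j) (i j : V) : x i = x j := by
  obtain ⟨p⟩ := hG.preconnected i j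
  induction p with
  | nil => rfl
  | cons hadj _ ih => exact (h _ _ hadj).trans ih

/-- if the sensory graph is connected, `D` is diagonal with nonnegative
entries at least one of which is positive, and `κ_f > 0`, then `D + κ_f L` is
positive definite (equivalently `-(D + κ_f L)` is Hurwitz). -/
theorem diagonal_add_smul_laplacian_posDef
    (N : ℕ) (hN : 2 ≤ N) (w : Fin N → Fin N → ℝ)
    (hw_symm : ∀ i j, w i j = w j i)
    (hw_nonneg : ∀ i j, 0 ≤ w i j)
    (hw_diag : ∀ i, w i i = 0)
    (L : Matrix (Fin N) (Fin N) ℝ)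
    (hL_diag : ∀ i, L i i = ∑ j, w i j)
    (hL_off : ∀ i j, i ≠ j → L i j = - w i j)
    (G : SimpleGraph (Fin N))
    (hG : ∀ i j, G.Adj i j ↔ (i ≠ j ∧ 0 < w i j))
    (hconn : G.Connected)
    (d : Fin N → ℝ) (hd_nonneg : ∀ i, 0 ≤ d i) (hd_pos : ∃ i, 0 < d i)
    (κf : ℝ) (hκf : 0 < κf) :
    (Matrix.diagonal d + κf • L).PosDef := by
  have hL : L = Matrix.diagonal (fun i => ∑ j, w i j) - Matrix.of w := by
    ext i j
    by_cases hij : i = j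
    · subst hij
      simp [hL_diag, hw_diag]
    · simp [hL_off i j hij, hij]
  have hform : ∀ x : Fin N → ℝ, x ⬝ᵥ ((Matrix.diagonal d + κf • L) *ᵥ x) =
      ∑ i, d i * x i ^ 2 + κf * ((∑ i, ∑ j, w i j * (x i - x j) ^ 2) / 2) := by
    intro x
    rw [Matrix.add_mulVec, dotProduct_add, Matrix.smul_mulVec, dotProduct_smul, hL,
      dotProduct_laplacian_mulVec w hw_symm, smul_eq_mul]
    congr 1
    simp only [dotProduct, Matrix.mulVec_diagonal]
    exact Finset.sum_congr rfl fun i _ => by ring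
  have hterm : ∀ (x : Fin N → ℝ) i j, 0 ≤ w i j * (x i - x j) ^ 2 := fun x i j =>
    mul_nonneg (hw_nonneg i j) (sq_nonneg _)
  refine Matrix.posDef_iff_dotProduct_mulVec.mpr ⟨?_, fun x hx => ?_⟩
  · ext i j
    by_cases hij : i = j
    · simp [hij]
    · simp [hL_off i j hij, hL_off j i (Ne.symm hij), hij, Ne.symm hij, hw_symm i j]
  · rw [star_trivial, hform]
    have hdterm : ∀ i, 0 ≤ d i * x i ^ 2 := fun i => mul_nonneg (hd_nonneg i) (sq_nonneg _)
    have hdsum : 0 ≤ ∑ i, d i * x i ^ 2 := Finset.sum_nonneg fun i _ => hdterm i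
    have hrow : ∀ i, 0 ≤ ∑ j, w i j * (x i - x j) ^ 2 := fun i =>
      Finset.sum_nonneg fun j _ => hterm x i j
    have hwsum : 0 ≤ ∑ i, ∑ j, w i j * (x i - x j) ^ 2 := Finset.sum_nonneg fun i _ => hrow i
    by_cases hconst : ∀ i j, G.Adj i j → x i = x j
    · obtain ⟨k, hk⟩ := hd_pos
      have hxk : x k ≠ 0 := fun h0 => hx <| funext fun i =>
        (hconn.apply_eq_of_adj hconst i k).trans h0
      have hpos : 0 < ∑ i, d i * x i ^ 2 := Finset.sum_pos' (fun i _ => hdterm i)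
        ⟨k, Finset.mem_univ k, mul_pos hk (by positivity)⟩
      positivity
    · push Not at hconst
      obtain ⟨i, j, hadj, hne⟩ := hconst
      have hpos : 0 < ∑ i, ∑ j, w i j * (x i - x j) ^ 2 := by
        refine Finset.sum_pos' (fun i _ => hrow i) ⟨i, Finset.mem_univ i, ?_⟩
        refine Finset.sum_pos' (fun j _ => hterm x i j) ⟨j, Finset.mem_univ j, ?_⟩
        exact mul_pos ((hG i j).mp hadj).2 (sq_pos_of_ne_zero (sub_ne_zero.mpr hne))
      positivity
end

section
/- Consider N ≥ 2 agents with double-integrator dynamics: twice differentiable x_i : ℝ → ℝ^n with x_i''(t) = u_i(t). Let h_i^d : ℝ → ℝ^n be twice differentiable desired trajectories, let w i j = w j i ≥ 0 with w i i = 0 be sensory weights, and define x̃_i = x_i − h_i^d, e_i = Σ_j w i j (x̃_i − x̃_j), and ξ_i = x̃_i' + κ_{g,i} x̃_i + κ_f e_i with constants κ_{g,i}, κ_f ∈ ℝ. Suppose each agent applies the control u_i = (h_i^d)'' − σ_i (x_i' − (h_i^d)') − κ_{g,i} [ (x_i' − (h_i^d)') + σ_i (x_i − h_i^d) ] − κ_f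 [ e_i' + σ_i e_i ], where σ_i ∈ ℝ^{n×n}. Then each ξ_i satisfies the closed-loop equation ξ_i'(t) = −σ_i ξ_i(t) for all t. -/
open Matrix BigOperators Filter

/-- for double-integrator agents `x_i'' = u_i` under the formation
tracking control law (with accurate positioning), the auxiliary signal
`ξ_i = x̃_i' + κ_{g,i} x̃_i + κ_f e_i` satisfies the closed-loop equation
`ξ_i' = -σ_i ξ_i`. -/
theorem closed_loop_auxiliary_dynamics
    (N n : ℕ) (hN : 2 ≤ N)
    (w : Fin N → Fin N → ℝ)
    (hw_symm : ∀ i j, w i j = w j i)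
    (hw_nonneg : ∀ i j, 0 ≤ w i j)
    (hw_diag : ∀ i, w i i = 0)
    (κg : Fin N → ℝ) (κf : ℝ)
    (σ : Fin N → Matrix (Fin n) (Fin n) ℝ)
    (x v hd hdv hda : Fin N → ℝ → Fin n → ℝ)
    (u : Fin N → ℝ → Fin n → ℝ)
    -- x_i is twice differentiable with velocity v_i and acceleration u_i
    (hx : ∀ i t, HasDerivAt (x i) (v i t) t)
    (hdyn : ∀ i t, HasDerivAt (v i) (u i t) t)
    -- h_i^d is twice differentiable with velocity hdv_i and acceleration hda_i
    (hhd : ∀ i t, HasDerivAt (hd i) (hdv i t) t)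
    (hhdv : ∀ i t, HasDerivAt (hdv i) (hda i t) t)
    -- the control law u_i = (h_i^d)'' - σ_i(x_i' - (h_i^d)') - κ_{g,i} f_i^g - κ_f f_i^l
    (hu : ∀ i t, u i t =
      hda i t - (σ i).mulVec (v i t - hdv i t)
        - κg i • ((v i t - hdv i t) + (σ i).mulVec (x i t - hd i t))
        - κf • ((∑ j, w i j • ((v i t - hdv i t) - (v j t - hdv j t)))
            + (σ i).mulVec (∑ j, w i j • ((x i t - hd i t) - (x j t - hd j t))))) :
    ∀ i t, HasDerivAt
      (fun s => (v i s - hdv i s) + κg i • (x i s - hd i s)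
          + κf • (∑ j, w i j • ((x i s - hd i s) - (x j s - hd j s))))
      (-(σ i).mulVec ((v i t - hdv i t) + κg i • (x i t - hd i t)
          + κf • (∑ j, w i j • ((x i t - hd i t) - (x j t - hd j t))))) t := by
  intro i t
  have herr (j) : HasDerivAt (fun s => x j s - hd j s) (v j t - hdv j t) t :=
    (hx j t).sub (hhd j t)
  have hsum : HasDerivAt (fun s => ∑ j, w i j • ((x i s - hd i s) - (x j s - hd j s)))
      (∑ j, w i j • ((v i t - hdv i t) - (v j t - hdv j t))) t :=
    HasDerivAt.fun_sum fun j _ => ((herr i).sub (herr j)).const_smul (w i j)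
  have hξ := (((hdyn i t).sub (hhdv i t)).add ((herr i).const_smul (κg i))).add
    (hsum.const_smul κf)
  refine hξ.congr_deriv ?_
  rw [hu i t, mulVec_add, mulVec_add, mulVec_smul, mulVec_smul]
  module
end

section
/- (Theorem 1, global formation tracking.) Consider N ≥ 2 agents with double-integrator dynamics x_i'' = u_i, x_i : ℝ → ℝ^n twice differentiable, symmetric nonnegative sensory weights w i j (w i i = 0) whose associated graph (edge iff w i j > 0) is connected, twice differentiable desired trajectories h_i^d : ℝ → ℝ^n, tracking errors x̃_i = x_i − h_i^d, inter-agent errors e_i = Σ_j w i j (x̃_i − x̃_j), gains κ_f > 0, κ_{g,i} > 0 and symmetric positive definite σ_i ∈ ℝ^{n×n}, and control u_i = (h_i^d)'' − σ_i(x_i' − (h_i^d)') − κ_{g,i}[(x_i' − (h_i^d)') + σ_i(x_i − h_i^d)] − κ_f[e_i' + σ_i e_i] (accurate global positioning x_i^g = x_i). Then for every i, x_i(t) − h_i^d(t) → 0 and x_i'(t) − (h_i^d)'(t) → 0 as t → ∞; consequently (x_i(t) − x_j(t)) − (h_i^d(t) − h_j^d(t)) → 0 for all pairs i, j, i.e.,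 global formation tracking also implies local formation tracking. -/
open Matrix BigOperators Filter

/-- A nonnegative function satisfying `f' ≤ -c f` with `c > 0` tends to zero. -/
theorem tendsto_zero_of_deriv_le_neg_mul {f f' : ℝ → ℝ} {c : ℝ} (hc : 0 < c)
    (hf : ∀ t, HasDerivAt f (f' t) t) (hle : ∀ t, f' t ≤ -c * f t) (h0 : ∀ t, 0 ≤ f t) :
    Tendsto f atTop (nhds 0) := by
  have hd : ∀ t, HasDerivAt (fun t => f t * Real.exp (c * t))
      ((f' t + c * f t) * Real.exp (c * t)) t := fun t => by
    have h1 : HasDerivAt (fun t => c * t) c t := by simpa using (hasDerivAt_id t).const_mul c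
    exact ((hf t).mul h1.exp).congr_deriv (by ring)
  have hanti : Antitone fun t => f t * Real.exp (c * t) :=
    antitone_of_hasDerivAt_nonpos hd fun t =>
      mul_nonpos_of_nonpos_of_nonneg (by linarith [hle t]) (Real.exp_pos _).le
  have hlim : Tendsto (fun t => f 0 * Real.exp (-(c * t))) atTop (nhds 0) := by
    have h1 : Tendsto (fun t => c * t) atTop atTop := tendsto_id.const_mul_atTop hc
    simpa using (Real.tendsto_exp_neg_atTop_nhds_zero.comp h1).const_mul (f 0)
  refine tendsto_of_tendsto_of_tendsto_of_le_of_le' tendsto_const_nhds hlim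
    (Eventually.of_forall h0) ?_
  filter_upwards [eventually_ge_atTop 0] with t ht
  have h1 : f t * Real.exp (c * t) ≤ f 0 := by simpa using hanti ht
  rwa [Real.exp_neg, ← div_eq_mul_inv, le_div_iff₀ (Real.exp_pos _)]

/-- The quadratic form of a positive definite real matrix is coercive. -/
theorem Matrix.PosDef.exists_pos_mul_dotProduct_self_le {n : Type*} [Fintype n]
    {A : Matrix n n ℝ} (hA : A.PosDef) :
    ∃ a > 0, ∀ u : n → ℝ, a * (u ⬝ᵥ u) ≤ u ⬝ᵥ A *ᵥ u := by
  have hK : IsCompact {u : n → ℝ | u ⬝ᵥ u = 1} := by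
    refine Metric.isCompact_of_isClosed_isBounded
      (isClosed_eq (by fun_prop) continuous_const) ?_
    refine (Metric.isBounded_closedBall (x := (0 : n → ℝ)) (r := 1)).subset fun u hu => ?_
    rw [mem_closedBall_zero_iff, pi_norm_le_iff_of_nonneg zero_le_one]
    intro i
    have h1 : u i * u i ≤ u ⬝ᵥ u :=
      Finset.single_le_sum (f := fun i => u i * u i) (fun j _ => mul_self_nonneg (u j))
        (Finset.mem_univ i)
    rw [show u ⬝ᵥ u = 1 from hu] at h1
    rw [Real.norm_eq_abs]
    exact abs_le_one_iff_mul_self_le_one.mpr h1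
  have hcont : Continuous fun u : n → ℝ => u ⬝ᵥ A *ᵥ u := by fun_prop
  obtain ⟨a, ha, hmin⟩ : ∃ a > 0, ∀ u : n → ℝ, u ⬝ᵥ u = 1 → a ≤ u ⬝ᵥ A *ᵥ u := by
    rcases Set.eq_empty_or_nonempty {u : n → ℝ | u ⬝ᵥ u = 1} with he | hne
    · exact ⟨1, one_pos, fun u hu => (Set.notMem_empty u (he ▸ hu)).elim⟩
    · obtain ⟨u, hu, hmin⟩ := hK.exists_isMinOn hne hcont.continuousOn
      refine ⟨_, ?_, fun v hv => hmin hv⟩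
      have hu0 : u ≠ 0 := by
        rintro rfl
        simp at hu
      simpa using hA.dotProduct_mulVec_pos hu0
  refine ⟨a, ha, fun u => ?_⟩
  by_cases hu : u = 0
  · simp [hu]
  have hpos : 0 < u ⬝ᵥ u := by simpa using dotProduct_star_self_pos_iff.mpr hu
  have hs : Real.sqrt (u ⬝ᵥ u) * Real.sqrt (u ⬝ᵥ u) = u ⬝ᵥ u := Real.mul_self_sqrt hpos.le
  have hs0 : Real.sqrt (u ⬝ᵥ u) ≠ 0 := (Real.sqrt_pos.mpr hpos).ne'
  have h1 := hmin ((Real.sqrt (u ⬝ᵥ u))⁻¹ • u) (by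
    simp only [smul_dotProduct, dotProduct_smul, smul_eq_mul]
    field_simp
    nlinarith)
  simp only [mulVec_smul, smul_dotProduct, dotProduct_smul, smul_eq_mul] at h1
  rw [← mul_assoc, ← mul_inv, hs, inv_mul_eq_div, le_div_iff₀ hpos] at h1
  exact h1

theorem HasDerivAt.dotProduct_self {n : Type*} [Fintype n] {u : ℝ → n → ℝ} {u' : n → ℝ} {t : ℝ}
    (hu : HasDerivAt u u' t) : HasDerivAt (fun t => u t ⬝ᵥ u t) (2 * (u t ⬝ᵥ u')) t := by
  have h1 := hasDerivAt_pi.mp hu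
  refine (HasDerivAt.fun_sum fun i (_ : i ∈ Finset.univ) => (h1 i).mul (h1 i)).congr_deriv ?_
  rw [dotProduct, Finset.mul_sum]
  exact Finset.sum_congr rfl fun i _ => by ring

theorem tendsto_zero_of_tendsto_dotProduct_self {α n : Type*} [Fintype n] {l : Filter α}
    {u : α → n → ℝ} (hu : Tendsto (fun t => u t ⬝ᵥ u t) l (nhds 0)) :
    Tendsto u l (nhds 0) := by
  refine tendsto_pi_nhds.mpr fun i => ?_
  have h1 : Tendsto (fun t => Real.sqrt (u t ⬝ᵥ u t)) l (nhds 0) := by simpa using hu.sqrt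
  refine squeeze_zero_norm (fun t => ?_) h1
  rw [Real.norm_eq_abs]
  refine Real.abs_le_sqrt ?_
  rw [pow_two]
  exact Finset.single_le_sum (f := fun i => u t i * u t i) (fun j _ => mul_self_nonneg (u t j))
    (Finset.mem_univ i)

/-- The quadratic form of a weighted Laplacian with symmetric nonnegative weights is
nonnegative. -/
theorem sum_dotProduct_sum_smul_sub_nonneg {ι n : Type*} [Fintype ι] [Fintype n]
    {w : ι → ι → ℝ} (hs : ∀ i j, w i j = w j i) (hw : ∀ i j, 0 ≤ w i j) (y : ι → n → ℝ) :
    0 ≤ ∑ i, y i ⬝ᵥ ∑ j, w i j • (y i - y j) := by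
  have h1 : ∑ i, y i ⬝ᵥ ∑ j, w i j • (y i - y j) = ∑ i, ∑ j, w i j * (y i ⬝ᵥ (y i - y j)) := by
    simp only [dotProduct_sum, dotProduct_smul, smul_eq_mul]
  have h2 : ∑ i, ∑ j, w i j * (y i ⬝ᵥ (y i - y j)) =
      ∑ i, ∑ j, w i j * (y j ⬝ᵥ (y j - y i)) := by
    rw [Finset.sum_comm]
    exact Finset.sum_congr rfl fun i _ => Finset.sum_congr rfl fun j _ => by rw [hs]
  have h3 : 0 ≤ ∑ i, ∑ j, w i j * ((y i - y j) ⬝ᵥ (y i - y j)) :=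
    Finset.sum_nonneg fun i _ => Finset.sum_nonneg fun j _ =>
      mul_nonneg (hw i j) (Finset.sum_nonneg fun k _ => mul_self_nonneg _)
  have h4 : ∑ i, ∑ j, w i j * ((y i - y j) ⬝ᵥ (y i - y j)) =
      ∑ i, ∑ j, w i j * (y i ⬝ᵥ (y i - y j)) + ∑ i, ∑ j, w i j * (y j ⬝ᵥ (y j - y i)) := by
    simp only [← Finset.sum_add_distrib]
    refine Finset.sum_congr rfl fun i _ => Finset.sum_congr rfl fun j _ => ?_
    simp only [sub_dotProduct, dotProduct_sub]
    ring
  linarith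

/-- If `r i = (y i)' + κg i • y i + κf • ∑ j, w i j • (y i - y j)` satisfies the linear equations
`(r i)' = -σ i r i` with positive definite `σ i`, then both `y` and `r` tend to zero. -/
theorem tendsto_zero_of_laplacian_cascade {ι n : Type*} [Fintype ι] [Nonempty ι] [Fintype n]
    {w : ι → ι → ℝ} (hs : ∀ i j, w i j = w j i) (hw : ∀ i j, 0 ≤ w i j)
    {κf : ℝ} (hκf : 0 < κf) {κg : ι → ℝ} (hκg : ∀ i, 0 < κg i)
    {σ : ι → Matrix n n ℝ} (hσ : ∀ i, (σ i).PosDef) {y r : ι → ℝ → n → ℝ}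
    (hy : ∀ i t, HasDerivAt (y i)
      (r i t - κg i • y i t - κf • ∑ j, w i j • (y i t - y j t)) t)
    (hr : ∀ i t, HasDerivAt (r i) (-(σ i *ᵥ r i t)) t) :
    (∀ i, Tendsto (y i) atTop (nhds 0)) ∧ ∀ i, Tendsto (r i) atTop (nhds 0) := by
  choose a ha hσa using fun i => (hσ i).exists_pos_mul_dotProduct_self_le
  obtain ⟨i₀, hi₀⟩ := Finite.exists_min a
  obtain ⟨i₁, hi₁⟩ := Finite.exists_min κg
  set b := a i₀
  set k := κg i₁
  have hb : 0 < b := ha i₀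
  have hk : 0 < k := hκg i₁
  have hsq : ∀ u : n → ℝ, 0 ≤ u ⬝ᵥ u := fun u => Finset.sum_nonneg fun _ _ => mul_self_nonneg _
  have hM : 0 < 1 / (k * b) := by positivity
  let W : ℝ → ℝ := fun t => ∑ i, (y i t ⬝ᵥ y i t + 1 / (k * b) * (r i t ⬝ᵥ r i t))
  have hterm : ∀ i t, 0 ≤ y i t ⬝ᵥ y i t + 1 / (k * b) * (r i t ⬝ᵥ r i t) := fun i t =>
    add_nonneg (hsq _) (mul_nonneg hM.le (hsq _))
  have hW : ∀ t, HasDerivAt W (∑ i, (2 * (y i t ⬝ᵥ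
      (r i t - κg i • y i t - κf • ∑ j, w i j • (y i t - y j t))) +
      1 / (k * b) * (2 * (r i t ⬝ᵥ -(σ i *ᵥ r i t))))) t := fun t =>
    HasDerivAt.fun_sum fun i _ =>
      (hy i t).dotProduct_self.add ((hr i t).dotProduct_self.const_mul _)
  have hle : ∀ t, ∑ i, (2 * (y i t ⬝ᵥ
      (r i t - κg i • y i t - κf • ∑ j, w i j • (y i t - y j t))) +
      1 / (k * b) * (2 * (r i t ⬝ᵥ -(σ i *ᵥ r i t)))) ≤ -min k b * W t := fun t => by
    have hL := mul_nonneg (mul_nonneg zero_le_two hκf.le)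
      (sum_dotProduct_sum_smul_sub_nonneg hs hw fun i => y i t)
    refine (le_add_of_nonneg_right hL).trans ?_
    rw [Finset.mul_sum, Finset.mul_sum, ← Finset.sum_add_distrib]
    refine Finset.sum_le_sum fun i _ => ?_
    have hYR := hsq (k • y i t - r i t)
    simp only [sub_dotProduct, dotProduct_sub, smul_dotProduct, dotProduct_smul, smul_eq_mul,
      dotProduct_neg, dotProduct_comm (r i t) (y i t)] at hYR ⊢
    have hR := hσa i (r i t)
    have hY := mul_le_mul_of_nonneg_right (hi₁ i) (hsq (y i t))
    have hR' := (mul_le_mul_of_nonneg_right (hi₀ i) (hsq (r i t))).trans hR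
    have hmin := mul_le_mul_of_nonneg_right (min_le_left k b) (hsq (y i t))
    have hmin' := mul_le_mul_of_nonneg_left
      (mul_le_mul_of_nonneg_right (min_le_right k b) (hsq (r i t))) hM.le
    have hR'' := mul_le_mul_of_nonneg_left hR' hM.le
    have hcross : 2 * (y i t ⬝ᵥ r i t) ≤
        k * (y i t ⬝ᵥ y i t) + 1 / (k * b) * (b * (r i t ⬝ᵥ r i t)) := by
      have : 1 / (k * b) * (b * (r i t ⬝ᵥ r i t)) = (r i t ⬝ᵥ r i t) / k := by field_simp
      rw [this, ← sub_le_iff_le_add', le_div_iff₀ hk]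
      linarith
    linarith
  have hlim := tendsto_zero_of_deriv_le_neg_mul (lt_min hk hb) hW hle
    fun t => Finset.sum_nonneg fun i _ => hterm i t
  have hterm_le : ∀ i t, y i t ⬝ᵥ y i t + 1 / (k * b) * (r i t ⬝ᵥ r i t) ≤ W t := fun i t =>
    Finset.single_le_sum (f := fun i => y i t ⬝ᵥ y i t + 1 / (k * b) * (r i t ⬝ᵥ r i t))
      (fun j _ => hterm j t) (Finset.mem_univ i)
  constructor <;> intro i <;> apply tendsto_zero_of_tendsto_dotProduct_self
  · refine squeeze_zero (fun t => hsq _) (fun t => ?_) hlim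
    linarith [hterm_le i t, mul_nonneg hM.le (hsq (r i t))]
  · refine squeeze_zero (fun t => hsq _) (fun t => ?_) (by simpa using hlim.const_mul (k * b))
    have h1 := hterm_le i t
    have h2 : 1 / (k * b) * (r i t ⬝ᵥ r i t) ≤ W t := by linarith [hsq (y i t)]
    rwa [one_div, inv_mul_le_iff₀ (by positivity)] at h2

/-- Theorem 1: global formation tracking: for double-integrator
agents under the formation-tracking control law with connected sensory graph,
positive gains and symmetric positive-definite `σ_i`, the global tracking errors
`x_i - h_i^d` and their derivatives converge to zero, and consequently the local
formation errors `(x_i - x_j) - (h_i^d - h_j^d)` converge to zero. -/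
theorem global_formation_tracking
    (N n : ℕ) (hN : 2 ≤ N)
    (w : Fin N → Fin N → ℝ)
    (hw_symm : ∀ i j, w i j = w j i)
    (hw_nonneg : ∀ i j, 0 ≤ w i j)
    (hw_diag : ∀ i, w i i = 0)
    (G : SimpleGraph (Fin N))
    (hG : ∀ i j, G.Adj i j ↔ (i ≠ j ∧ 0 < w i j))
    (hconn : G.Connected)
    (κf : ℝ) (hκf : 0 < κf)
    (κg : Fin N → ℝ) (hκg : ∀ i, 0 < κg i)
    (σ : Fin N → Matrix (Fin n) (Fin n) ℝ)
    (hσh : ∀ i, (σ i).IsHermitian) (hσp : ∀ i, (σ i).PosDef)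
    (x v hd hdv hda : Fin N → ℝ → Fin n → ℝ)
    -- x_i is twice differentiable with velocity v_i
    (hx : ∀ i t, HasDerivAt (x i) (v i t) t)
    -- h_i^d is twice differentiable with velocity hdv_i and acceleration hda_i
    (hhd : ∀ i t, HasDerivAt (hd i) (hdv i t) t)
    (hhdv : ∀ i t, HasDerivAt (hdv i) (hda i t) t)
    -- closed-loop dynamics: x_i'' = u_i with the formation tracking control law
    (hdyn : ∀ i t, HasDerivAt (v i)
      (hda i t - (σ i).mulVec (v i t - hdv i t)
        - κg i • ((v i t - hdv i t) + (σ i).mulVec (x i t - hd i t))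
        - κf • ((∑ j, w i j • ((v i t - hdv i t) - (v j t - hdv j t)))
            + (σ i).mulVec (∑ j, w i j • ((x i t - hd i t) - (x j t - hd j t))))) t) :
    (∀ i, Tendsto (fun t => x i t - hd i t) atTop (nhds 0))
    ∧ (∀ i, Tendsto (fun t => v i t - hdv i t) atTop (nhds 0))
    ∧ (∀ i j, Tendsto (fun t => (x i t - x j t) - (hd i t - hd j t)) atTop (nhds 0)) := by
  have : Nonempty (Fin N) := ⟨⟨0, by omega⟩⟩
  have hy' : ∀ i t, HasDerivAt (fun t => x i t - hd i t) (v i t - hdv i t) t :=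
    fun i t => (hx i t).sub (hhd i t)
  have hz' := fun i t => (hdyn i t).sub (hhdv i t)
  let r : Fin N → ℝ → Fin n → ℝ := fun i t => (v i t - hdv i t) + κg i • (x i t - hd i t) +
    κf • ∑ j, w i j • ((x i t - hd i t) - (x j t - hd j t))
  obtain ⟨hy, hr⟩ := tendsto_zero_of_laplacian_cascade hw_symm hw_nonneg hκf hκg hσp
    (y := fun i t => x i t - hd i t) (r := r)
    (fun i t => (hy' i t).congr_deriv (by simp only [r]; abel))
    (fun i t => by
      refine (((hz' i t).add ((hy' i t).const_smul (κg i))).add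
        ((HasDerivAt.fun_sum fun j (_ : j ∈ Finset.univ) =>
          ((hy' i t).sub (hy' j t)).const_smul (w i j)).const_smul κf)).congr_deriv ?_
      simp only [r, mulVec_add, mulVec_smul, smul_add]
      abel)
  refine ⟨hy, fun i => ?_, fun i j => ?_⟩
  · have h1 := ((hr i).sub ((hy i).const_smul (κg i))).sub
      ((tendsto_finsetSum Finset.univ fun j _ =>
        ((hy i).sub (hy j)).const_smul (w i j)).const_smul κf)
    simp only [sub_zero, smul_zero, Finset.sum_const_zero] at h1
    exact h1.congr fun t => by simp only [r]; abel
  · have h1 := (hy i).sub (hy j)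
    rw [sub_zero] at h1
    exact h1.congr fun t => by abel
end

section
/- (Local formation tracking with only local measurements, κ_g = 0.) Let L ∈ ℝ^{N×N} be the weighted Laplacian of symmetric nonnegative weights whose associated graph is connected, and let κ_f > 0. Let ξ : ℝ → ℝ^{Nn} be continuous with ξ(t) → 0 as t → ∞, and let y : ℝ → ℝ^{Nn} be differentiable with y'(t) = −[(κ_f L) ⊗ I_n] y(t) + ξ(t) for all t ≥ 0. Then, writing y = (y_1, …, y_N) with y_i ∈ ℝ^n, the system reaches consensus: y_i(t) − y_j(t) → 0 as t → ∞ for all i, j. -/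
open Matrix BigOperators Filter Kronecker

/-- A nonnegative function with `W' ≤ -a W + b`, `a > 0` and `b → 0`, tends to zero. -/
theorem tendsto_zero_of_deriv_le_neg_mul_add {a : ℝ} (ha : 0 < a) {W W' b : ℝ → ℝ}
    (hW0 : ∀ t, 0 ≤ W t) (hW : ∀ t, 0 ≤ t → HasDerivAt W (W' t) t)
    (hle : ∀ t, 0 ≤ t → W' t ≤ -a * W t + b t) (hb : Tendsto b atTop (nhds 0)) :
    Tendsto W atTop (nhds 0) := by
  rw [Metric.tendsto_atTop]
  intro ε hε
  have hbε : ∀ᶠ t in atTop, b t < a * (ε / 2) := hb.eventually_lt_const (by positivity)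
  obtain ⟨T₀, hT₀⟩ := eventually_atTop.1 hbε
  set T := max T₀ 0
  have hderiv : ∀ t, 0 ≤ t → HasDerivAt (fun s => Real.exp (a * s) * (W s - ε / 2))
      (Real.exp (a * t) * a * (W t - ε / 2) + Real.exp (a * t) * W' t) t := fun t ht => by
    have hexp : HasDerivAt (fun s => Real.exp (a * s)) (Real.exp (a * t) * a) t := by
      simpa using ((hasDerivAt_id t).const_mul a).exp
    exact hexp.mul ((hW t ht).sub_const _)
  have hanti : AntitoneOn (fun s => Real.exp (a * s) * (W s - ε / 2)) (Set.Ici T) := by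
    have hT : 0 ≤ T := le_max_right _ _
    refine antitoneOn_of_deriv_nonpos (convex_Ici T)
      (fun t ht => (hderiv t (hT.trans ht)).continuousAt.continuousWithinAt)
      (fun t ht => ?_) (fun t ht => ?_)
    · rw [interior_Ici] at ht
      exact (hderiv t (hT.trans ht.le)).differentiableAt.differentiableWithinAt
    · rw [interior_Ici] at ht
      have ht' : T < t := ht
      rw [(hderiv t (hT.trans ht'.le)).deriv]
      have h1 := hle t (hT.trans ht'.le)
      have h2 := hT₀ t ((le_max_left _ _).trans ht'.le)
      have h3 : a * (W t - ε / 2) + W' t ≤ 0 := by linarith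
      nlinarith [Real.exp_pos (a * t)]
  set K := Real.exp (a * T) * (W T - ε / 2)
  have hdecay : Tendsto (fun t => K * Real.exp (-(a * t))) atTop (nhds 0) := by
    have h := (Real.tendsto_exp_neg_atTop_nhds_zero.comp
      (tendsto_id.const_mul_atTop ha)).const_mul K
    simpa using h
  obtain ⟨S, hS⟩ := eventually_atTop.1 (hdecay.eventually_lt_const (half_pos hε))
  refine ⟨max S T, fun t ht => ?_⟩
  have h1 : Real.exp (a * t) * (W t - ε / 2) ≤ K :=
    hanti Set.self_mem_Ici ((le_max_right _ _).trans ht) ((le_max_right _ _).trans ht)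
  have h2 := hS t ((le_max_left _ _).trans ht)
  have h3 : W t - ε / 2 ≤ K * Real.exp (-(a * t)) := by
    rw [Real.exp_neg, ← div_eq_mul_inv, le_div_iff₀ (Real.exp_pos _)]
    linarith
  rw [Real.dist_eq, sub_zero, abs_of_nonneg (hW0 t)]
  linarith

section WeightedGraph

variable {ι : Type*} [Fintype ι] {w : ι → ι → ℝ} {G : SimpleGraph ι}

theorem sum_mul_sum_weight_mul_sub (hw_symm : ∀ i j, w i j = w j i) (x : ι → ℝ) :
    ∑ i, x i * ∑ j, w i j * (x i - x j) = (∑ i, ∑ j, w i j * (x i - x j) ^ 2) / 2 := by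
  have h : ∑ i, x i * ∑ j, w i j * (x i - x j) = ∑ i, ∑ j, -(w i j * x j * (x i - x j)) := by
    simp_rw [Finset.mul_sum]
    rw [Finset.sum_comm]
    refine Finset.sum_congr rfl fun i _ => Finset.sum_congr rfl fun j _ => ?_
    rw [hw_symm j i]
    ring
  have h' : ∑ i, ∑ j, w i j * (x i - x j) ^ 2 =
      ∑ i, x i * ∑ j, w i j * (x i - x j) + ∑ i, ∑ j, -(w i j * x j * (x i - x j)) := by
    simp_rw [Finset.mul_sum, ← Finset.sum_add_distrib]
    refine Finset.sum_congr rfl fun i _ => Finset.sum_congr rfl fun j _ => ?_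
    ring
  linarith

theorem sum_sum_sub_sq_of_sum_eq_zero {x : ι → ℝ} (hx : ∑ i, x i = 0) :
    ∑ i, ∑ j, (x i - x j) ^ 2 = 2 * Fintype.card ι * ∑ i, x i ^ 2 := by
  simp_rw [sub_sq, Finset.sum_add_distrib, Finset.sum_sub_distrib, ← Finset.mul_sum, hx]
  simp [← Finset.mul_sum]
  ring

/-- The difference across a pair of reachable vertices is controlled by the Dirichlet energy. -/
theorem exists_sub_sq_le_energy_of_reachable (hw_nonneg : ∀ i j, 0 ≤ w i j)
    (hG : ∀ i j, G.Adj i j → 0 < w i j) {i j : ι} (hij : G.Reachable i j) :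
    ∃ C, 0 ≤ C ∧ ∀ x : ι → ℝ,
      (x i - x j) ^ 2 ≤ C * ∑ a, ∑ b, w a b * (x a - x b) ^ 2 := by
  rw [SimpleGraph.reachable_iff_reflTransGen] at hij
  induction hij with
  | refl => exact ⟨0, le_rfl, fun x => by simp⟩
  | @tail k l _ hkl ih =>
    obtain ⟨C, hC, h⟩ := ih
    have hw := hG k l hkl
    refine ⟨2 * C + 2 * (w k l)⁻¹, by positivity, fun x => ?_⟩
    have hterm : ∀ a b, 0 ≤ w a b * (x a - x b) ^ 2 :=
      fun a b => mul_nonneg (hw_nonneg a b) (sq_nonneg _)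
    have hedge : w k l * (x k - x l) ^ 2 ≤ ∑ a, ∑ b, w a b * (x a - x b) ^ 2 :=
      (Finset.single_le_sum (f := fun b => w k b * (x k - x b) ^ 2)
        (fun b _ => hterm k b) (Finset.mem_univ l)).trans
      (Finset.single_le_sum (f := fun a => ∑ b, w a b * (x a - x b) ^ 2)
        (fun a _ => Finset.sum_nonneg fun b _ => hterm a b) (Finset.mem_univ k))
    have hkl' : (x k - x l) ^ 2 ≤ (w k l)⁻¹ * ∑ a, ∑ b, w a b * (x a - x b) ^ 2 := by
      rwa [← div_eq_inv_mul, le_div_iff₀' hw]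
    nlinarith [h x, sq_nonneg ((x i - x k) - (x k - x l))]

/-- Poincaré inequality: the algebraic connectivity of a connected weighted graph is positive. -/
theorem exists_pos_mul_sum_sq_le_energy (hw_nonneg : ∀ i j, 0 ≤ w i j)
    (hG : ∀ i j, G.Adj i j → 0 < w i j) (hconn : G.Connected) :
    ∃ c, 0 < c ∧ ∀ x : ι → ℝ, ∑ i, x i = 0 →
      c * ∑ i, x i ^ 2 ≤ ∑ i, ∑ j, w i j * (x i - x j) ^ 2 := by
  choose C hC h using fun i j =>
    exists_sub_sq_le_energy_of_reachable hw_nonneg hG (hconn.preconnected i j)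
  have : Nonempty ι := hconn.nonempty
  have hcard : (0 : ℝ) < Fintype.card ι := by exact_mod_cast Fintype.card_pos
  have hS : 0 ≤ ∑ i, ∑ j, C i j := Finset.sum_nonneg fun i _ => Finset.sum_nonneg fun j _ => hC i j
  refine ⟨2 * Fintype.card ι / (1 + ∑ i, ∑ j, C i j), by positivity, fun x hx => ?_⟩
  have hE : 0 ≤ ∑ i, ∑ j, w i j * (x i - x j) ^ 2 := Finset.sum_nonneg fun i _ =>
    Finset.sum_nonneg fun j _ => mul_nonneg (hw_nonneg i j) (sq_nonneg _)
  have hle : ∑ i, ∑ j, (x i - x j) ^ 2 ≤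
      (∑ i, ∑ j, C i j) * ∑ i, ∑ j, w i j * (x i - x j) ^ 2 := by
    rw [Finset.sum_mul]
    refine Finset.sum_le_sum fun i _ => ?_
    rw [Finset.sum_mul]
    exact Finset.sum_le_sum fun j _ => h i j x
  rw [sum_sum_sub_sq_of_sum_eq_zero hx] at hle
  rw [div_mul_eq_mul_div, div_le_iff₀ (by positivity)]
  linarith

/-- Scalar consensus dynamics on a connected weighted graph, driven by a vanishing input,
reach consensus. -/
theorem tendsto_sub_of_hasDerivAt_consensus (hw_symm : ∀ i j, w i j = w j i)
    (hw_nonneg : ∀ i j, 0 ≤ w i j) (hG : ∀ i j, G.Adj i j → 0 < w i j) (hconn : G.Connected)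
    {κ : ℝ} (hκ : 0 < κ) {ξ z : ι → ℝ → ℝ} (hξ : ∀ i, Tendsto (ξ i) atTop (nhds 0))
    (hz : ∀ i t, 0 ≤ t →
      HasDerivAt (z i) (-(κ * ∑ j, w i j * (z i t - z j t)) + ξ i t) t) (i j : ι) :
    Tendsto (fun t => z i t - z j t) atTop (nhds 0) := by
  obtain ⟨c, hc, hpoinc⟩ := exists_pos_mul_sum_sq_le_energy hw_nonneg hG hconn
  have : Nonempty ι := hconn.nonempty
  have hcard : (Fintype.card ι : ℝ) ≠ 0 := by exact_mod_cast Fintype.card_ne_zero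
  set p : ι → ℝ → ℝ := fun i t => z i t - (∑ j, z j t) / Fintype.card ι with hp
  set d : ι → ℝ → ℝ := fun i t => -(κ * ∑ j, w i j * (z i t - z j t)) + ξ i t with hd
  have hpsum : ∀ t, ∑ i, p i t = 0 := fun t => by
    simp only [hp, Finset.sum_sub_distrib, Finset.sum_const, Finset.card_univ, nsmul_eq_mul]
    field_simp
    ring
  have hW : Tendsto (fun t => ∑ i, p i t ^ 2) atTop (nhds 0) := by
    refine tendsto_zero_of_deriv_le_neg_mul_add (a := κ * c / 2)
      (W' := fun t => ∑ i, 2 * p i t * (d i t - (∑ j, d j t) / Fintype.card ι))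
      (b := fun t => 2 / (κ * c) * ∑ i, ξ i t ^ 2) (by positivity)
      (fun t => Finset.sum_nonneg fun i _ => sq_nonneg _) (fun t ht => ?_) (fun t ht => ?_) ?_
    · refine HasDerivAt.fun_sum fun i _ => ?_
      have h := ((hz i t ht).fun_sub
        ((HasDerivAt.fun_sum fun j (_ : j ∈ Finset.univ) => hz j t ht).div_const
          (Fintype.card ι : ℝ))).fun_pow 2
      simpa using h
    · have hsplit : ∑ i, 2 * p i t * (d i t - (∑ j, d j t) / Fintype.card ι) =
          2 * ∑ i, p i t * d i t := by
        have h0 : ∑ i, p i t * ((∑ j, d j t) / Fintype.card ι) = 0 := by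
          rw [← Finset.sum_mul, hpsum, zero_mul]
        rw [← sub_zero (∑ i, p i t * d i t), ← h0, ← Finset.sum_sub_distrib, Finset.mul_sum]
        exact Finset.sum_congr rfl fun i _ => by ring
      have hdiss : ∑ i, p i t * d i t =
          -(κ * ((∑ i, ∑ j, w i j * (p i t - p j t) ^ 2) / 2)) + ∑ i, p i t * ξ i t := by
        rw [← sum_mul_sum_weight_mul_sub hw_symm fun i => p i t, Finset.mul_sum,
          ← Finset.sum_neg_distrib, ← Finset.sum_add_distrib]
        refine Finset.sum_congr rfl fun i _ => ?_
        have hdiff : ∀ j, p i t - p j t = z i t - z j t := fun j => by simp [hp]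
        simp only [hdiff, hd]
        ring
      have hyoung : 2 * ∑ i, p i t * ξ i t ≤
          κ * c / 2 * ∑ i, p i t ^ 2 + 2 / (κ * c) * ∑ i, ξ i t ^ 2 := by
        simp only [Finset.mul_sum, ← Finset.sum_add_distrib]
        refine Finset.sum_le_sum fun i _ => ?_
        have hκc : 0 < κ * c := by positivity
        have h : κ * c / 2 * p i t ^ 2 + 2 / (κ * c) * ξ i t ^ 2 - 2 * (p i t * ξ i t) =
            (κ * c * p i t - 2 * ξ i t) ^ 2 / (2 * (κ * c)) := by
          field_simp
          ring
        have : 0 ≤ (κ * c * p i t - 2 * ξ i t) ^ 2 / (2 * (κ * c)) := by positivity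
        linarith
      have hP := mul_le_mul_of_nonneg_left (hpoinc (fun i => p i t) (hpsum t)) hκ.le
      rw [hsplit, hdiss]
      linarith
    · have h := (tendsto_finsetSum Finset.univ fun i _ => (hξ i).pow 2).const_mul (2 / (κ * c))
      simpa using h
  have hp0 : ∀ i, Tendsto (p i) atTop (nhds 0) := fun i => by
    refine squeeze_zero_norm (a := fun t => √(∑ i, p i t ^ 2)) (fun t => ?_) (by simpa using hW.sqrt)
    exact Real.abs_le_sqrt
      (Finset.single_le_sum (f := fun i => p i t ^ 2) (fun i _ => sq_nonneg _) (Finset.mem_univ i))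
  simpa [hp] using (hp0 i).sub (hp0 j)

end WeightedGraph

theorem laplacian_mulVec_apply {ι : Type*} [Fintype ι] [DecidableEq ι] {w : ι → ι → ℝ}
    (hw_diag : ∀ i, w i i = 0) {L : Matrix ι ι ℝ} (hL_diag : ∀ i, L i i = ∑ j, w i j)
    (hL_off : ∀ i j, i ≠ j → L i j = -w i j) (x : ι → ℝ) (i : ι) :
    ∑ j, L i j * x j = ∑ j, w i j * (x i - x j) := by
  have hL : ∀ j, L i j = (if i = j then ∑ k, w i k else 0) - w i j := fun j => by
    split_ifs with h
    · subst h
      rw [hL_diag, hw_diag, sub_zero]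
    · rw [hL_off i j h, zero_sub]
  simp [hL, sub_mul, mul_sub, Finset.sum_mul]

theorem kronecker_one_mulVec_apply {ι κ R : Type*} [Fintype ι] [Fintype κ] [DecidableEq κ]
    [CommSemiring R] (A : Matrix ι ι R) (v : ι × κ → R) (i : ι) (k : κ) :
    ((A ⊗ₖ (1 : Matrix κ κ R)).mulVec v) (i, k) = ∑ j, A i j * v (j, k) := by
  simp [Matrix.mulVec, dotProduct, Fintype.sum_prod_type, Matrix.one_apply]

/-- local formation tracking with only local measurements, κ_g = 0:
with a connected sensory graph, `κ_f > 0` and vanishing input `ξ`, the solution of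
`y' = -[(κ_f L) ⊗ I_n] y + ξ` reaches consensus: `y_i(t) - y_j(t) → 0` for all i, j. -/
theorem consensus_local_measurements_only
    (N n : ℕ) (hN : 2 ≤ N)
    (w : Fin N → Fin N → ℝ)
    (hw_symm : ∀ i j, w i j = w j i)
    (hw_nonneg : ∀ i j, 0 ≤ w i j)
    (hw_diag : ∀ i, w i i = 0)
    (L : Matrix (Fin N) (Fin N) ℝ)
    (hL_diag : ∀ i, L i i = ∑ j, w i j)
    (hL_off : ∀ i j, i ≠ j → L i j = - w i j)
    (G : SimpleGraph (Fin N))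
    (hG : ∀ i j, G.Adj i j ↔ (i ≠ j ∧ 0 < w i j))
    (hconn : G.Connected)
    (κf : ℝ) (hκf : 0 < κf)
    (ξ : ℝ → (Fin N × Fin n → ℝ)) (hξc : Continuous ξ)
    (hξ : Tendsto ξ atTop (nhds 0))
    (y : ℝ → (Fin N × Fin n → ℝ))
    (hy : ∀ t : ℝ, 0 ≤ t → HasDerivAt y
      (-(((κf • L) ⊗ₖ (1 : Matrix (Fin n) (Fin n) ℝ)).mulVec (y t)) + ξ t) t) :
    ∀ i j : Fin N,
      Tendsto (fun t => (fun k : Fin n => y t (i, k) - y t (j, k))) atTop (nhds 0) := by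
  intro i j
  rw [tendsto_pi_nhds]
  intro k
  refine tendsto_sub_of_hasDerivAt_consensus (z := fun i t => y t (i, k))
    (ξ := fun i t => ξ t (i, k)) hw_symm hw_nonneg (fun a b hab => ((hG a b).1 hab).2) hconn hκf
    (fun a => tendsto_pi_nhds.1 hξ (a, k)) (fun a t ht => ?_) i j
  have h := hasDerivAt_pi.1 (hy t ht) (a, k)
  rw [Pi.add_apply, Pi.neg_apply, kronecker_one_mulVec_apply] at h
  simp only [Matrix.smul_apply, smul_eq_mul, mul_assoc] at h
  rwa [← Finset.mul_sum,
    laplacian_mulVec_apply hw_diag hL_diag hL_off (fun b => y t (b, k)) a] at h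
end
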